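/- arXiv:2211.02962 — 2 statements merged into one kernel-verified Lean document; each statement's English description precedes it below -/
import Mathlib

section
/- For a topological space X the following are equivalent: (1) X is star-K-Hurewicz: for every sequence (𝒰ₙ)_{n∈ℕ} of open covers of X there exist compact sets Kₙ ⊆ X such that every point of X belongs to St(Kₙ,𝒰ₙ) for all but finitely many n; (2) X satisfies SS*_comp(𝒪,𝒪^gp): for every sequence (𝒰ₙ)_{n∈ℕ} of open covers of X there exist compact sets Kₙ ⊆ X such that the sequence (St(Kₙ,𝒰ₙ))_{n∈ℕ} is groupable. -/
open Set Filter

/-- The star of a set `A` with respect to a family `P` of sets: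
the union of all members of `P` that meet `A`. -/
def st {X : Type*} (A : Set X) (P : Set (Set X)) : Set X :=
  ⋃₀ {B | B ∈ P ∧ (A ∩ B).Nonempty}

/-- `P` is an open cover of the space `X`. -/
def IsOpenCover {X : Type*} [TopologicalSpace X] (P : Set (Set X)) : Prop :=
  (∀ U ∈ P, IsOpen U) ∧ ⋃₀ P = Set.univ

/-- A sequence of subsets of `X` is groupable if there is an increasing sequence
`m 0 < m 1 < ⋯` of naturals such that every `x ∈ X` belongs to the union of the
block `A (m k), …, A (m (k+1) - 1)` for all but finitely many `k`. -/
def Groupable {X : Type*} (A : ℕ → Set X) : Prop :=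
  ∃ m : ℕ → ℕ, StrictMono m ∧ ∀ x : X, ∀ᶠ k in Filter.atTop,
    x ∈ ⋃ i ∈ Set.Ico (m k) (m (k + 1)), A i

/-- A sequence of open covers has a sequence of open covers whose `n`-th term refines
the first `n + 1` given covers. -/
theorem exists_isOpenCover_refining {X : Type*} [TopologicalSpace X] (U : ℕ → Set (Set X))
    (hU : ∀ n, IsOpenCover (U n)) :
    ∃ V : ℕ → Set (Set X), (∀ n, IsOpenCover (V n)) ∧
      ∀ n, ∀ i ≤ n, ∀ W ∈ V n, ∃ B ∈ U i, W ⊆ B := by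
  refine ⟨fun n => {W | IsOpen W ∧ ∀ i ≤ n, ∃ B ∈ U i, W ⊆ B},
    fun n => ⟨fun W hW => hW.1, ?_⟩, fun n i hi W hW => hW.2 i hi⟩
  refine eq_univ_of_forall fun x => ?_
  have hx : ∀ i, ∃ B ∈ U i, x ∈ B := fun i =>
    mem_sUnion.1 ((hU i).2.symm ▸ mem_univ x)
  choose B hB hxB using hx
  refine ⟨⋂ i ∈ Set.Iic n, B i, ⟨?_, fun i hi => ⟨B i, hB i, ?_⟩⟩, ?_⟩
  · exact (Set.finite_Iic n).isOpen_biInter fun i _ => (hU i).1 _ (hB i)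
  · exact biInter_subset_of_mem hi
  · exact mem_iInter₂.2 fun i _ => hxB i

/-- The star is monotone in the set, and grows when the family is coarsened. -/
theorem st_subset_st {X : Type*} {A A' : Set X} {P P' : Set (Set X)} (hA : A ⊆ A')
    (hP : ∀ W ∈ P, ∃ B ∈ P', W ⊆ B) : st A P ⊆ st A' P' := by
  rintro x ⟨W, ⟨hW, hne⟩, hx⟩
  obtain ⟨B, hB, hWB⟩ := hP W hW
  exact ⟨B, ⟨hB, hne.mono (inter_subset_inter hA hWB)⟩, hWB hx⟩

/-- `X` is star-K-Hurewicz iff `X` satisfies `SS*_comp(𝒪,𝒪^gp)`. -/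
theorem stmt4 {X : Type*} [TopologicalSpace X] :
    (∀ U : ℕ → Set (Set X), (∀ n, IsOpenCover (U n)) →
      ∃ K : ℕ → Set X, (∀ n, IsCompact (K n)) ∧
        ∀ x : X, ∀ᶠ n in Filter.atTop, x ∈ st (K n) (U n)) ↔
    (∀ U : ℕ → Set (Set X), (∀ n, IsOpenCover (U n)) →
      ∃ K : ℕ → Set X, (∀ n, IsCompact (K n)) ∧
        Groupable (fun n => st (K n) (U n))) := by
  constructor
  · intro h U hU
    obtain ⟨K, hK, hx⟩ := h U hU
    refine ⟨K, hK, id, strictMono_id, fun x => (hx x).mono fun k hk => ?_⟩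
    exact mem_biUnion (show k ∈ Set.Ico k (k + 1) from ⟨le_rfl, k.lt_succ_self⟩) hk
  · intro h U hU
    obtain ⟨V, hV, hVU⟩ := exists_isOpenCover_refining U hU
    obtain ⟨K, hK, m, hm, hx⟩ := h V hV
    refine ⟨fun n => ⋃ i ∈ Set.Ico (m n) (m (n + 1)), K i,
      fun n => (Set.finite_Ico _ _).isCompact_biUnion fun i _ => hK i,
      fun x => (hx x).mono fun n hn => ?_⟩
    obtain ⟨i, hi, hxi⟩ := mem_iUnion₂.1 hn
    exact st_subset_st (subset_biUnion_of_mem hi)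
      (hVU i n ((hm.le_apply).trans hi.1)) hxi
end

section
/- Let X be a strongly star-ε-space with X = ⋃_{α<κ} X_α for a cardinal κ < cov(M), where each subspace X_α satisfies S₁(Ω,Γ): for every sequence (𝒱ₙ)_{n∈ℕ} of ω-covers of X_α there exist Vₙ ∈ 𝒱ₙ such that every point of X_α belongs to Vₙ for all but finitely many n. Then X is strongly star-Rothberger. -/
open Set Filter

/-- `cov(M)`: the least cardinality of a family `F ⊆ ℕ^ℕ` that cannot be
guessed by a single `g ∈ ℕ^ℕ` (i.e. there is no `g` agreeing with every member
of `F` infinitely often). -/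
noncomputable def covM : Cardinal :=
  sInf {c : Cardinal | ∃ F : Set (ℕ → ℕ), Cardinal.mk F = c ∧
    ¬ ∃ g : ℕ → ℕ, ∀ f ∈ F, {n : ℕ | f n = g n}.Infinite}

/-- `P` is an ω-cover of `X`: an open cover not containing `X` itself such that
every finite subset of `X` is contained in some member. -/
def IsOmegaCover {X : Type*} [TopologicalSpace X] (P : Set (Set X)) : Prop :=
  IsOpenCover P ∧ Set.univ ∉ P ∧ ∀ F : Set X, F.Finite → ∃ U ∈ P, F ⊆ U

/-- A space `Z` satisfies `S₁(Ω,Γ)`: for every sequence of ω-covers one can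
select a member from each so that every point lies in the selected member
for all but finitely many indices. -/
def S1OmegaGamma (Z : Type*) [TopologicalSpace Z] : Prop :=
  ∀ V : ℕ → Set (Set Z), (∀ n, IsOmegaCover (V n)) →
    ∃ W : ℕ → Set Z, (∀ n, W n ∈ V n) ∧
      ∀ z : Z, ∀ᶠ n in Filter.atTop, z ∈ W n

/-- `X` is strongly star-Rothberger. -/
def StronglyStarRothberger (X : Type*) [TopologicalSpace X] : Prop :=
  ∀ U : ℕ → Set (Set X), (∀ n, IsOpenCover (U n)) →
    ∃ x : ℕ → X, (⋃ n, st {x n} (U n)) = Set.univ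

/-- `X` is a strongly star-ε-space: for every open cover `P` there is a
countable `A ⊆ X` such that every finite subset of `X` is contained in
`St(x,P)` for some `x ∈ A`. -/
def StronglyStarEpsilonSpace (X : Type*) [TopologicalSpace X] : Prop :=
  ∀ P : Set (Set X), IsOpenCover P → ∃ A : Set X, A.Countable ∧
    ∀ F : Set X, F.Finite → ∃ x ∈ A, F ⊆ st {x} P

theorem isOpen_st {X : Type*} [TopologicalSpace X] {P : Set (Set X)} (hP : IsOpenCover P)
    (A : Set X) : IsOpen (st A P) :=
  isOpen_sUnion fun B hB => hP.1 B hB.1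

/-- A family of fewer than `covM` functions can be guessed infinitely often by one function. -/
theorem exists_infinite_eq_of_mk_lt_covM {ι : Type} (hι : Cardinal.mk ι < covM)
    (f : ι → ℕ → ℕ) : ∃ g : ℕ → ℕ, ∀ i, {n : ℕ | f i n = g n}.Infinite := by
  by_contra hg
  refine notMem_of_lt_csInf' (lt_of_le_of_lt (Cardinal.mk_range_le (f := f)) hι)
    ⟨range f, rfl, fun ⟨g, hg'⟩ => hg ⟨g, fun i => hg' _ (mem_range_self i)⟩⟩

/-- In a strongly star-ε-space, the countable set of centres can be given as a sequence. -/
theorem StronglyStarEpsilonSpace.exists_seq {X : Type*} [TopologicalSpace X]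
    (hX : StronglyStarEpsilonSpace X) {P : Set (Set X)} (hP : IsOpenCover P) :
    ∃ a : ℕ → X, ∀ F : Set X, F.Finite → ∃ k, F ⊆ st {a k} P := by
  obtain ⟨A, hA, hAF⟩ := hX P hP
  obtain ⟨x, hx, -⟩ := hAF ∅ finite_empty
  obtain ⟨a, rfl⟩ := hA.exists_eq_range ⟨x, hx⟩
  refine ⟨a, fun F hF => ?_⟩
  obtain ⟨_, ⟨k, rfl⟩, hk⟩ := hAF F hF
  exact ⟨k, hk⟩

/-- If each row of a double sequence of open sets captures all finite subsets of a space
satisfying `S₁(Ω,Γ)`, then one set can be chosen from each row so that every point lies in almost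
all of them, even if some of the sets are the whole space. -/
theorem S1OmegaGamma.exists_eventually_mem {Z : Type*} [TopologicalSpace Z]
    (hZ : S1OmegaGamma Z) (O : ℕ → ℕ → Set Z) (hO : ∀ n k, IsOpen (O n k))
    (hfin : ∀ n, ∀ F : Set Z, F.Finite → ∃ k, F ⊆ O n k) :
    ∃ f : ℕ → ℕ, ∀ z, ∀ᶠ n in atTop, z ∈ O n (f n) := by
  have hω (n : ℕ) (hn : ∀ k, O n k ≠ univ) : IsOmegaCover (range (O n)) := by
    refine ⟨⟨?_, ?_⟩, ?_, ?_⟩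
    · rintro _ ⟨k, rfl⟩
      exact hO n k
    · refine eq_univ_of_forall fun z => ?_
      obtain ⟨k, hk⟩ := hfin n {z} (finite_singleton z)
      exact ⟨O n k, mem_range_self k, hk rfl⟩
    · rintro ⟨k, hk⟩
      exact hn k hk
    · intro F hF
      obtain ⟨k, hk⟩ := hfin n F hF
      exact ⟨O n k, mem_range_self k, hk⟩
  by_cases hall : ∀ n, ∃ k, O n k = univ
  · choose f hf using hall
    exact ⟨f, fun z => Eventually.of_forall fun n => by simp [hf n]⟩
  push Not at hall
  obtain ⟨m, hm⟩ := hall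
  classical
  obtain ⟨W, hW, hWz⟩ := hZ
    (fun n => if ∀ k, O n k ≠ univ then range (O n) else range (O m)) fun n => by
      split_ifs with hn
      exacts [hω n hn, hω m hm]
  have key (n : ℕ) : ∃ k, W n ⊆ O n k := by
    by_cases hn : ∀ k, O n k ≠ univ
    · have hWn := hW n
      rw [if_pos hn] at hWn
      obtain ⟨k, hk⟩ := hWn
      exact ⟨k, hk.ge⟩
    · push Not at hn
      obtain ⟨k, hk⟩ := hn
      exact ⟨k, hk ▸ subset_univ _⟩
  choose f hf using key
  exact ⟨f, fun z => (hWz z).mono fun n hn => hf n hn⟩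

/-- If a strongly star-ε-space `X` is a union of fewer than `cov(M)` many
subspaces each satisfying `S₁(Ω,Γ)`, then `X` is strongly star-Rothberger. -/
theorem stmt17 {X : Type} [TopologicalSpace X] (hε : StronglyStarEpsilonSpace X)
    {ι : Type} (hκ : Cardinal.mk ι < covM) (Xa : ι → Set X)
    (hcov : (⋃ i, Xa i) = Set.univ)
    (h : ∀ i, S1OmegaGamma (Xa i)) :
    StronglyStarRothberger X := by
  intro U hU
  choose a ha using fun n => hε.exists_seq (hU n)
  have hsel (i : ι) : ∃ f : ℕ → ℕ, ∀ z : Xa i,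
      ∀ᶠ n in atTop, z ∈ ((↑) ⁻¹' st {a n (f n)} (U n) : Set (Xa i)) := by
    refine (h i).exists_eventually_mem (fun n k => (↑) ⁻¹' st {a n k} (U n))
      (fun n k => (isOpen_st (hU n) _).preimage continuous_subtype_val) fun n F hF => ?_
    obtain ⟨k, hk⟩ := ha n _ (hF.image (↑))
    exact ⟨k, image_subset_iff.1 hk⟩
  choose f hf using hsel
  obtain ⟨g, hg⟩ := exists_infinite_eq_of_mk_lt_covM hκ f
  refine ⟨fun n => a n (g n), eq_univ_of_forall fun x => ?_⟩
  obtain ⟨i, hi⟩ := mem_iUnion.1 (hcov ▸ mem_univ x)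
  obtain ⟨n, hn, hxn⟩ :=
    ((Nat.frequently_atTop_iff_infinite.2 (hg i)).and_eventually (hf i ⟨x, hi⟩)).exists
  rw [hn] at hxn
  exact mem_iUnion.2 ⟨n, hxn⟩
end
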